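/- Let d, j, k, s, p be integers with 0 ≤ k < j < d, s ≥ 0 and 0 ≤ p ≤ ⌊s/2⌋. Then (1/√π) · ∑_{b=0}^{⌊s/2⌋-p} (-1)^b C(s-2p, 2b) · Γ(b + 1/2) · Γ((k+2+s-2b-2p)/2) · Γ((d-j+2b+2p)/2) / Γ((2b+2p+d+1)/2) = [Γ((k+2+s-2p)/2) Γ((d-j+2p)/2) / Γ((2p+d+1)/2)] · ∑_{b=0}^{⌊s/2⌋-p} [(-(s-2p)/2)_b · (-(s-2p-1)/2)_b · ((d-j+2p)/2)_b] / [b! · ((2p+d+1)/2)_b · (-(k+s-2p)/2)_b]. (All rising factorials occurring in denominators are nonzero, since b ≤ (s-2p)/2 ≤ (k+s-2p)/2 for all b in the range of summation.) -/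

import Mathlib

open MeasureTheory Real Filter

/-- The rising factorial (Pochhammer symbol) `(x)_n = x (x+1) ⋯ (x+n-1)`. -/
noncomputable def poch (x : ℝ) (n : ℕ) : ℝ := (ascPochhammer ℝ n).eval x

theorem poch_zero (x : ℝ) : poch x 0 = 1 := by simp [poch]

theorem poch_succ (x : ℝ) (n : ℕ) : poch x (n + 1) = poch x n * (x + n) := by
  simp [poch, ascPochhammer_succ_eval]

theorem poch_pos {x : ℝ} (hx : 0 < x) (n : ℕ) : 0 < poch x n :=
  ascPochhammer_pos n x hx

theorem Gamma_add_natCast {x : ℝ} (hx : 0 < x) (n : ℕ) :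
    Real.Gamma (x + n) = Real.Gamma x * poch x n := by
  induction n with
  | zero => simp [poch_zero]
  | succ n ih =>
    have h : x + n ≠ 0 := by positivity
    rw [poch_succ, Nat.cast_succ, ← add_assoc, Real.Gamma_add_one h, ih]
    ring

theorem poch_neg_ne_zero {y : ℝ} {n : ℕ} (h : (n : ℝ) ≤ y) : poch (-y) n ≠ 0 := by
  induction n with
  | zero => simp [poch_zero]
  | succ n ih =>
    push_cast at h
    rw [poch_succ]
    exact mul_ne_zero (ih (by linarith)) (by linarith)

/-- The reflected form of `Gamma_add_natCast`. -/
theorem Gamma_sub_natCast_mul_poch_neg {y : ℝ} {n : ℕ} (h : (n : ℝ) ≤ y) :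
    Real.Gamma (y + 1 - n) * poch (-y) n = (-1) ^ n * Real.Gamma (y + 1) := by
  induction n with
  | zero => simp [poch_zero]
  | succ n ih =>
    push_cast at h ⊢
    have hy : y - n ≠ 0 := by linarith
    have hG := Real.Gamma_add_one hy
    have ih := ih (by linarith)
    rw [show y + 1 - (n : ℝ) = y - n + 1 by ring, hG] at ih
    rw [poch_succ, pow_succ, show y + 1 - ((n : ℝ) + 1) = y - n by ring]
    linear_combination -ih

theorem cast_choose_succ_mul (n m : ℕ) :
    (n.choose (m + 1) : ℝ) * (m + 1) = n.choose m * ((n : ℝ) - m) := by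
  rcases le_or_gt m n with h | h
  · rw [← Nat.cast_sub h]
    exact_mod_cast Nat.choose_succ_right_eq n m
  · simp [Nat.choose_eq_zero_of_lt h, Nat.choose_eq_zero_of_lt (h.trans (Nat.lt_succ_self m))]

theorem choose_two_mul_mul_Gamma_mul_factorial (n b : ℕ) :
    (n.choose (2 * b) : ℝ) * Real.Gamma ((b : ℝ) + 1 / 2) * b.factorial =
      √π * (poch (-((n : ℝ) / 2)) b * poch (-(((n : ℝ) - 1) / 2)) b) := by
  induction b with
  | zero => simp [poch_zero, -one_div, Real.Gamma_one_half_eq]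
  | succ b ih =>
    have hb : (b : ℝ) + 1 / 2 ≠ 0 := by positivity
    have h₁ := cast_choose_succ_mul n (2 * b)
    have h₂ := cast_choose_succ_mul n (2 * b + 1)
    push_cast at h₁ h₂ ⊢
    rw [poch_succ, poch_succ, Nat.factorial_succ, show 2 * (b + 1) = 2 * b + 1 + 1 by ring,
      show (b : ℝ) + 1 + 1 / 2 = b + 1 / 2 + 1 by ring, Real.Gamma_add_one hb]
    push_cast
    linear_combination ((n : ℝ) - 2 * b) * ((n : ℝ) - 2 * b - 1) / 4 * ih +
      Real.Gamma ((b : ℝ) + 1 / 2) * b.factorial / 4 *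
        ((2 * b + 1) * h₂ + ((n : ℝ) - 2 * b - 1) * h₁)

theorem statement8 (d j k s p : ℕ) (hkj : k < j) (hjd : j < d) (hp : p ≤ s / 2) :
    (1 / Real.sqrt Real.pi) *
        ∑ b ∈ Finset.range (s / 2 - p + 1),
          (-1 : ℝ) ^ b * ((s - 2 * p).choose (2 * b) : ℝ) * Real.Gamma ((b : ℝ) + 1 / 2) *
            Real.Gamma (((k : ℝ) + 2 + s - 2 * b - 2 * p) / 2) *
            Real.Gamma (((d : ℝ) - j + 2 * b + 2 * p) / 2) /
            Real.Gamma ((2 * (b : ℝ) + 2 * p + d + 1) / 2) =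
      Real.Gamma (((k : ℝ) + 2 + s - 2 * p) / 2) * Real.Gamma (((d : ℝ) - j + 2 * p) / 2) /
          Real.Gamma ((2 * (p : ℝ) + d + 1) / 2) *
        ∑ b ∈ Finset.range (s / 2 - p + 1),
          poch (-(((s : ℝ) - 2 * p) / 2)) b * poch (-(((s : ℝ) - 2 * p - 1) / 2)) b *
              poch (((d : ℝ) - j + 2 * p) / 2) b /
            ((b.factorial : ℝ) * poch ((2 * (p : ℝ) + d + 1) / 2) b *
              poch (-(((k : ℝ) + s - 2 * p) / 2)) b) := by
  obtain ⟨n, rfl⟩ : ∃ n, s = n + 2 * p := ⟨s - 2 * p, by omega⟩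
  have hjd' : (j : ℝ) < d := by exact_mod_cast hjd
  rw [Finset.mul_sum, Finset.mul_sum]
  refine Finset.sum_congr rfl fun b hb => ?_
  have hbn : 2 * b ≤ n := by
    have := Finset.mem_range.1 hb
    omega
  have hbn' : 2 * (b : ℝ) ≤ n := by exact_mod_cast hbn
  have hk : (0 : ℝ) ≤ k := k.cast_nonneg
  have hy : (b : ℝ) ≤ ((k : ℝ) + n) / 2 := by linarith
  have hu : 0 < ((d : ℝ) - j + 2 * p) / 2 := by
    have : (0 : ℝ) ≤ p := p.cast_nonneg
    linarith
  have hv : 0 < (2 * (p : ℝ) + d + 1) / 2 := by positivity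
  have hchoose := choose_two_mul_mul_Gamma_mul_factorial n b
  have hrefl := Gamma_sub_natCast_mul_poch_neg hy
  have hne := poch_neg_ne_zero hy
  have hvne := (poch_pos hv b).ne'
  have hGv := (Real.Gamma_pos_of_pos hv).ne'
  have hfac : (b.factorial : ℝ) ≠ 0 := by positivity
  have hpi : √π ≠ 0 := by positivity
  have hsign : ((-1 : ℝ) ^ b) * (-1) ^ b = 1 := by rw [← mul_pow]; simp
  rw [Nat.add_sub_cancel]
  push_cast
  rw [show ((k : ℝ) + 2 + (n + 2 * p) - 2 * b - 2 * p) / 2 = (k + n) / 2 + 1 - b by ring,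
    show ((d : ℝ) - j + 2 * b + 2 * p) / 2 = (d - j + 2 * p) / 2 + b by ring,
    show (2 * (b : ℝ) + 2 * p + d + 1) / 2 = (2 * p + d + 1) / 2 + b by ring,
    show ((k : ℝ) + 2 + (n + 2 * p) - 2 * p) / 2 = (k + n) / 2 + 1 by ring,
    show ((k : ℝ) + (n + 2 * p) - 2 * p) / 2 = (k + n) / 2 by ring,
    show (n : ℝ) + 2 * p - 2 * p = n by ring,
    Gamma_add_natCast hu, Gamma_add_natCast hv]
  generalize Real.Gamma (((k : ℝ) + n) / 2 + 1 - b) = G at *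
  generalize Real.Gamma (((k : ℝ) + n) / 2 + 1) = H at *
  generalize poch (-(((k : ℝ) + n) / 2)) b = Q at *
  have key : (-1 : ℝ) ^ b * (n.choose (2 * b) : ℝ) * Real.Gamma ((b : ℝ) + 1 / 2) * G *
      b.factorial * Q =
      √π * H * (poch (-((n : ℝ) / 2)) b * poch (-(((n : ℝ) - 1) / 2)) b) := by
    linear_combination (-1 : ℝ) ^ b * G * Q * hchoose +
      (-1 : ℝ) ^ b * √π * (poch (-((n : ℝ) / 2)) b * poch (-(((n : ℝ) - 1) / 2)) b) * hrefl +
      √π * H * (poch (-((n : ℝ) / 2)) b * poch (-(((n : ℝ) - 1) / 2)) b) * hsign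
  generalize poch (-((n : ℝ) / 2)) b = A at *
  generalize poch (-(((n : ℝ) - 1) / 2)) b = B at *
  generalize Real.Gamma ((b : ℝ) + 1 / 2) = E at *
  generalize Real.Gamma (((d : ℝ) - j + 2 * p) / 2) = U at *
  generalize poch (((d : ℝ) - j + 2 * p) / 2) b = U' at *
  generalize Real.Gamma ((2 * (p : ℝ) + d + 1) / 2) = V at *
  generalize poch ((2 * (p : ℝ) + d + 1) / 2) b = V' at *
  generalize (-1 : ℝ) ^ b = e at *
  generalize √π = r at *
  rw [one_div_mul_eq_div, div_div, div_mul_div_comm, div_eq_div_iff (by positivity) (by positivity)]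
  linear_combination U * U' * V * V' * key
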